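/- Let F = (f₁,…,f_p) ∈ ℂ[X₁,…,X_n]^p and fix i ∈ {1,…,n−p+1}. Suppose that 0 is a regular value of the n+p−i polynomials (f₁,…,f_p, the n−i entries of [L₁ ⋯ L_p]·jac(F,i)) on the open set {(x,ℓ) ∈ ℂⁿ × ℂ^p : ℓ ≠ 0}, and suppose that σ = (σ₁,…,σ_{i−1}) ∈ ℂ^{i−1} is such that 0 is a regular value of the n+p−1 polynomials (X₁−σ₁,…,X_{i−1}−σ_{i−1}, f₁,…,f_p, the n−i entries of [L₁ ⋯ L_p]·jac(F,i)) on the same open set. Then for every u = (u₁,…,u_p) ∈ ℂ^p, at every common zero (x,ℓ) ∈ ℂ^{n+p} of the n+p polynomials (X₁−σ₁,…,X_{i−1}−σ_{i−1}, f₁,…,f_p, the n−i entries of [L₁ ⋯ L_p]·jac(F,i), u₁L₁+⋯+u_pL_p−1), the (n+p)×(n+p) Jacobian matrix of these polynomials with respect to X₁,…,X_n,L₁,…,L_p is invertible; i.e., 0 is a regular value of this system on all of ℂ^{n+p}. -/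

import Mathlib

open MvPolynomial

noncomputable section

/-- The Jacobian matrix of a family of polynomials, evaluated at a point. -/
def jacEval {ι σ : Type*} [Fintype ι] [Fintype σ]
    (G : ι → MvPolynomial σ ℂ) (y : σ → ℂ) : Matrix ι σ ℂ :=
  Matrix.of fun j k => eval y (pderiv k (G j))

/-- `0` is a regular value of `G` on `U`. -/
def IsRegularValueOn {ι σ : Type*} [Fintype ι] [Fintype σ]
    (G : ι → MvPolynomial σ ℂ) (U : Set (σ → ℂ)) : Prop :=
  ∀ y ∈ U, (∀ j, eval y (G j) = 0) → (jacEval G y).rank = Fintype.card ι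

/-- The index (as an element of `Fin n`) of the `c`-th of the last `n - i` variables. -/
def colIdx (n i : ℕ) (c : Fin (n - i)) : Fin n :=
  ⟨i + c, by have := c.isLt; omega⟩

/-- The `c`-th entry of the row vector `[L₁ ⋯ L_p]·jac(G, i)`. -/
def lagEntry {n p : ℕ} (G : Fin p → MvPolynomial (Fin n) ℂ) (i : ℕ) (c : Fin (n - i)) :
    MvPolynomial (Fin n ⊕ Fin p) ℂ :=
  ∑ k : Fin p, X (Sum.inr k) * rename Sum.inl (pderiv (colIdx n i c) (G k))

/-- The system of `n + p − i` polynomials `(G, [L₁ ⋯ L_p]·jac(G, i))`. -/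
def hSys {n p : ℕ} (G : Fin p → MvPolynomial (Fin n) ℂ) (i : ℕ) :
    (Fin p ⊕ Fin (n - i)) → MvPolynomial (Fin n ⊕ Fin p) ℂ :=
  Sum.elim (fun j => rename Sum.inl (G j)) (fun c => lagEntry G i c)

/-- The system of `n + p − 1` polynomials
`(X₁−σ₁,…,X_{i−1}−σ_{i−1}, G, [L₁ ⋯ L_p]·jac(G, i))`. -/
def fiberSys {n p : ℕ} (G : Fin p → MvPolynomial (Fin n) ℂ) (i : ℕ)
    (hin : i - 1 ≤ n) (σ : Fin (i - 1) → ℂ) :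
    (Fin (i - 1) ⊕ (Fin p ⊕ Fin (n - i))) → MvPolynomial (Fin n ⊕ Fin p) ℂ :=
  Sum.elim
    (fun t => X (Sum.inl (Fin.castLE hin t)) - C (σ t))
    (hSys G i)

/-- The full square system of `n + p` polynomials
`(X₁−σ₁,…,X_{i−1}−σ_{i−1}, G, [L₁ ⋯ L_p]·jac(G, i), u₁L₁+⋯+u_pL_p−1)`. -/
def fullSys {n p : ℕ} (G : Fin p → MvPolynomial (Fin n) ℂ) (i : ℕ)
    (hin : i - 1 ≤ n) (σ : Fin (i - 1) → ℂ) (u : Fin p → ℂ) :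
    ((Fin (i - 1) ⊕ (Fin p ⊕ Fin (n - i))) ⊕ Unit) → MvPolynomial (Fin n ⊕ Fin p) ℂ :=
  Sum.elim (fiberSys G i hin σ)
    (fun _ => (∑ k : Fin p, C (u k) * X (Sum.inr k)) - 1)

open scoped Matrix

/-- Adjoining to a family of linearly independent rows killed by `v` one row not killed by `v`
yields linearly independent rows. -/
theorem Matrix.linearIndependent_row_of_mulVec {K ι σ : Type*} [Field K] [Fintype ι] [Fintype σ]
    (M : Matrix (ι ⊕ Unit) σ K) (v : σ → K)
    (hM : LinearIndependent K fun j => M (Sum.inl j))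
    (hv : ∀ j, (M *ᵥ v) (Sum.inl j) = 0) (hv' : (M *ᵥ v) (Sum.inr ()) ≠ 0) :
    LinearIndependent K M.row := by
  rw [Fintype.linearIndependent_iff] at hM ⊢
  intro a ha
  have hvec : a ᵥ* M = 0 := by
    rw [← ha]; ext k; simp [Matrix.vecMul, dotProduct, Matrix.row]
  have hlast : a (Sum.inr ()) = 0 := by
    have h : a ⬝ᵥ (M *ᵥ v) = 0 := by rw [Matrix.dotProduct_mulVec, hvec, zero_dotProduct]
    simpa [dotProduct, hv, hv'] using h
  rintro (j | ⟨⟩)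
  · refine hM (fun j => a (Sum.inl j)) ?_ j
    simpa [hlast, Matrix.row] using ha
  · exact hlast

/-- The Jacobian has full rank exactly when its rows are linearly independent. -/
theorem rank_jacEval_eq_card_iff {ι σ : Type*} [Fintype ι] [Fintype σ]
    (G : ι → MvPolynomial σ ℂ) (y : σ → ℂ) :
    (jacEval G y).rank = Fintype.card ι ↔ LinearIndependent ℂ (jacEval G y).row := by
  rw [linearIndependent_iff_card_eq_finrank_span, Matrix.rank_eq_finrank_span_row, eq_comm]
  rfl

theorem pderiv_inr_rename_inl {R α β : Type*} [CommSemiring R] (k : β) (f : MvPolynomial α R) :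
    pderiv (Sum.inr k) (rename (Sum.inl : α → α ⊕ β) f) = 0 := by
  classical
  refine pderiv_eq_zero_of_notMem_vars fun h => ?_
  simpa using Finset.mem_of_subset (vars_rename _ _) h

/-- The vector `(0, ℓ)` lies in the kernel of the Jacobian of the fiber system at a common zero
`(x, ℓ)`, because the Lagrange equations are homogeneous linear in `ℓ`. -/
theorem jacEval_fiberSys_mulVec_inr {n p : ℕ} (G : Fin p → MvPolynomial (Fin n) ℂ) (i : ℕ)
    (hin : i - 1 ≤ n) (σ : Fin (i - 1) → ℂ) (y : Fin n ⊕ Fin p → ℂ)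
    (hy : ∀ j, eval y (fiberSys G i hin σ j) = 0) :
    jacEval (fiberSys G i hin σ) y *ᵥ Sum.elim 0 (y ∘ Sum.inr) = 0 := by
  ext (t | j | c)
  · simp [Matrix.mulVec, dotProduct, jacEval, fiberSys, pderiv_X]
  · simp [Matrix.mulVec, dotProduct, jacEval, fiberSys, hSys, pderiv_inr_rename_inl]
  · have h := hy (Sum.inr (Sum.inr c))
    simp only [fiberSys, hSys, lagEntry, Sum.elim_inr, map_sum, map_mul, eval_X] at h
    simpa [Matrix.mulVec, dotProduct, jacEval, fiberSys, hSys, lagEntry, pderiv_inr_rename_inl,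
      pderiv_X, Pi.single_apply, apply_ite (eval y), mul_comm] using h

/-- if `0` is a regular value of `(F, [L₁ ⋯ L_p]·jac(F,i))` where `L ≠ 0`
and `σ` satisfies `H_i'`, then for every `u ∈ ℂ^p` the square Lagrange system
`(X₁−σ₁,…,X_{i−1}−σ_{i−1}, F, [L₁ ⋯ L_p]·jac(F,i), u₁L₁+⋯+u_pL_p−1)` has a full-rank
(invertible) Jacobian at each of its common zeros: `0` is a regular value of this
system on all of `ℂ^{n+p}`. -/
theorem full_lagrange_system_regular
    (n p : ℕ) (hn : 0 < n) (hp : 0 < p)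
    (F : Fin p → MvPolynomial (Fin n) ℂ)
    (i : ℕ) (hi1 : 1 ≤ i) (hi2 : i ≤ n - p + 1)
    (hreg : IsRegularValueOn (hSys F i) {z | z ∘ Sum.inr ≠ 0})
    (σ : Fin (i - 1) → ℂ)
    (hσ : IsRegularValueOn (fiberSys F i (show i - 1 ≤ n by omega) σ)
      {z | z ∘ Sum.inr ≠ 0}) :
    ∀ u : Fin p → ℂ,
      IsRegularValueOn (fullSys F i (show i - 1 ≤ n by omega) σ u) Set.univ := by
  intro u y _ hy
  have hfib : ∀ j, eval y (fiberSys F i (show i - 1 ≤ n by omega) σ j) = 0 :=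
    fun j => hy (Sum.inl j)
  have hu : ∑ k, u k * y (Sum.inr k) = 1 := by
    simpa [fullSys, sub_eq_zero] using hy (Sum.inr ())
  have hℓ : y ∘ Sum.inr ≠ 0 := by
    intro h
    have h' : ∀ k, y (Sum.inr k) = 0 := congrFun h
    simp [h'] at hu
  refine (rank_jacEval_eq_card_iff _ _).2 (Matrix.linearIndependent_row_of_mulVec _
    (Sum.elim 0 (y ∘ Sum.inr)) ((rank_jacEval_eq_card_iff _ _).1 (hσ y hℓ hfib))
    (fun j => congrFun (jacEval_fiberSys_mulVec_inr F i _ σ y hfib) j) ?_)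
  have hrow : (jacEval (fullSys F i (show i - 1 ≤ n by omega) σ u) y *ᵥ
      Sum.elim 0 (y ∘ Sum.inr)) (Sum.inr ()) = 1 := by
    simpa [Matrix.mulVec, dotProduct, jacEval, fullSys, pderiv_X, Pi.single_apply,
      apply_ite (eval y)] using hu
  rw [hrow]
  exact one_ne_zero

end
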